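/- Let m ≥ 1. (i) If f ∈ ℂ[x,t] has deg_x f = m and satisfies B_(m) f = 0, then there exist g ∈ ℂ[t] and h ∈ ℂ[x,t] such that h is monic in x of degree m, B_(m) h = 0, and f = g·h; moreover g is the leading x-coefficient of f. (ii) Conversely, if h ∈ ℂ[x,t] is monic in x of degree m with B_(m) h = 0, then for every g ∈ ℂ[t] the product g·h satisfies B_(m)(g·h) = 0. Hence the solutions of B_(m) of x-degree at most m of exact degree m form the union of the ℂ[t]-multiples of monic solutions (fundamental solutions). -/

import Mathlib

open Polynomial

/-- Formal partial derivative with respect to `t` on `ℂ[t][x]`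
(outer variable `x`, inner variable `t`). -/
noncomputable def dt (f : Polynomial (Polynomial ℂ)) : Polynomial (Polynomial ℂ) :=
  f.sum fun n a => Polynomial.C (Polynomial.derivative a) * Polynomial.X ^ n

/-- Formal partial derivative with respect to `x` on `ℂ[t][x]`. -/
noncomputable def dx (f : Polynomial (Polynomial ℂ)) : Polynomial (Polynomial ℂ) :=
  Polynomial.derivative f

/-- The operator `T f = 2 f_{xt} f − 2 f_t f_x + 6 (f_{xx})²`; the generalized bilinear
KdV-type equation is `T f = 0`. -/
noncomputable def Tkdv (f : Polynomial (Polynomial ℂ)) : Polynomial (Polynomial ℂ) :=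
  2 * dx (dt f) * f - 2 * dt f * dx f + 6 * (dx (dx f)) ^ 2

/-- `B_(m) f = 0`: the coefficient of `x^p` in `T f` vanishes for every `p ≥ m − 1`
(equivalently `deg_x (T f) ≤ m − 2`). -/
def Bzero (m : ℕ) (f : Polynomial (Polynomial ℂ)) : Prop :=
  ∀ p : ℕ, m - 1 ≤ p → (Tkdv f).coeff p = 0

lemma coeff_dt (f : Polynomial (Polynomial ℂ)) (n : ℕ) :
    (dt f).coeff n = derivative (f.coeff n) := by
  unfold dt
  rw [Polynomial.sum, finsetSum_coeff]
  simp only [coeff_C_mul_X_pow]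
  rw [Finset.sum_ite_eq, ite_eq_left_iff, notMem_support_iff]
  intro h
  rw [h, derivative_zero]

lemma dt_add (f g : Polynomial (Polynomial ℂ)) : dt (f + g) = dt f + dt g := by
  ext1 n
  simp [coeff_dt]

lemma dt_C_mul (a : Polynomial ℂ) (h : Polynomial (Polynomial ℂ)) :
    dt (C a * h) = C (derivative a) * h + C a * dt h := by
  ext1 n
  simp [coeff_dt]

lemma natDegree_dt_le {f : Polynomial (Polynomial ℂ)} {n : ℕ} (hf : f.natDegree ≤ n) :
    (dt f).natDegree ≤ n := by
  rw [natDegree_le_iff_coeff_eq_zero] at hf ⊢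
  intro N hN
  rw [coeff_dt, hf N hN, derivative_zero]

lemma Tkdv_C_mul (a : Polynomial ℂ) (h : Polynomial (Polynomial ℂ)) :
    Tkdv (C a * h) = C (a ^ 2) * Tkdv h := by
  simp only [Tkdv, dx, dt_C_mul, derivative_mul, derivative_add, derivative_C, derivative_zero,
    C_pow]
  ring

lemma Tkdv_add (F r : Polynomial (Polynomial ℂ)) :
    Tkdv (F + r) = Tkdv F + Tkdv r + 2 * (dx (dt F) * r) + 2 * (dx (dt r) * F)
      - 2 * (dx r * dt F) - 2 * (dx F * dt r) + 12 * (dx (dx F) * dx (dx r)) := by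
  simp only [Tkdv, dx, dt_add, derivative_add]
  ring

lemma coeff_X_mul_dx_mul {p q : Polynomial (Polynomial ℂ)} {m k : ℕ}
    (hp : p.natDegree ≤ m) (hq : q.natDegree ≤ k) :
    (X * (dx p * q)).coeff (m + k) = m * p.coeff m * q.coeff k := by
  have hcoeff (n : ℕ) : (X * dx p).coeff n = n * p.coeff n := by
    cases n with
    | zero => simp
    | succ n => rw [coeff_X_mul, dx, coeff_derivative]; push_cast; ring
  have hdeg : (X * dx p).natDegree ≤ m := by
    rw [natDegree_le_iff_coeff_eq_zero] at hp ⊢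
    intro N hN
    rw [hcoeff, hp N hN, mul_zero]
  rw [← mul_assoc, coeff_mul_add_eq_of_natDegree_le hdeg hq, hcoeff]

lemma coeff_X_mul_dx_dx_mul {p q : Polynomial (Polynomial ℂ)} {m k : ℕ}
    (hp : p.natDegree ≤ m) (hq : q.natDegree ≤ k) :
    (X * (dx (dx p) * dx (dx q))).coeff (m + k) = 0 := by
  have hle {s : Polynomial (Polynomial ℂ)} {n : ℕ} (hs : s.natDegree ≤ n) :
      (dx s).natDegree ≤ n :=
    (natDegree_derivative_le s).trans ((Nat.sub_le _ _).trans hs)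
  rw [coeff_X_mul_dx_mul (hle hp) (hle (hle hq)), dx, coeff_derivative,
    coeff_eq_zero_of_natDegree_lt (Nat.lt_succ_of_le hp)]
  simp

lemma coeff_X_mul_Tkdv_eq_zero {r : Polynomial (Polynomial ℂ)} {m k : ℕ}
    (hr : r.natDegree ≤ k) (hkm : k < m) : (X * Tkdv r).coeff (m + k) = 0 := by
  have hrm : r.coeff m = 0 := coeff_eq_zero_of_natDegree_lt (hr.trans_lt hkm)
  have e : X * Tkdv r = C 2 * (X * (dx (dt r) * r)) - C 2 * (X * (dx r * dt r))
      + C 6 * (X * (dx (dx r) * dx (dx r))) := by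
    simp only [Tkdv, map_ofNat]
    ring
  rw [e, coeff_add, coeff_sub, coeff_C_mul, coeff_C_mul, coeff_C_mul,
    coeff_X_mul_dx_mul (natDegree_dt_le (hr.trans hkm.le)) hr,
    coeff_X_mul_dx_mul (hr.trans hkm.le) (natDegree_dt_le hr),
    coeff_X_mul_dx_dx_mul (hr.trans hkm.le) hr, coeff_dt, hrm]
  simp

lemma coeff_X_mul_Tkdv_add {F r : Polynomial (Polynomial ℂ)} {m k : ℕ}
    (hF : F.natDegree ≤ m) (hr : r.natDegree ≤ k) (hkm : k < m) :
    (X * Tkdv (F + r)).coeff (m + k) = (X * Tkdv F).coeff (m + k)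
      - 2 * (m - k) * wronskian (F.coeff m) (r.coeff k) := by
  have e : X * Tkdv (F + r) = X * Tkdv F + X * Tkdv r + C 2 * (X * (dx (dt F) * r))
      + C 2 * (X * (dx (dt r) * F)) - C 2 * (X * (dx r * dt F)) - C 2 * (X * (dx F * dt r))
      + C 12 * (X * (dx (dx F) * dx (dx r))) := by
    simp only [Tkdv_add, map_ofNat]
    ring
  have hFt := natDegree_dt_le hF
  have hrt := natDegree_dt_le hr
  have h₁ := coeff_X_mul_dx_mul hrt hF
  have h₂ := coeff_X_mul_dx_mul hr hFt
  rw [add_comm k m] at h₁ h₂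
  simp only [e, coeff_add, coeff_sub, coeff_C_mul, h₁, h₂, coeff_X_mul_dx_mul hFt hr,
    coeff_X_mul_dx_mul hF hrt, coeff_X_mul_dx_dx_mul hF hr, coeff_X_mul_Tkdv_eq_zero hr hkm,
    coeff_dt, wronskian]
  ring

lemma exists_derivative_eq {K : Type*} [Field K] [CharZero K] (q : Polynomial K) :
    ∃ Q : Polynomial K, derivative Q = q := by
  induction q using Polynomial.induction_on' with
  | add p q hp hq =>
    obtain ⟨P, rfl⟩ := hp
    obtain ⟨Q, rfl⟩ := hq
    exact ⟨P + Q, derivative_add⟩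
  | monomial n c =>
    refine ⟨monomial (n + 1) (c / (n + 1)), ?_⟩
    rw [derivative_monomial, Nat.add_sub_cancel, Nat.cast_succ,
      div_mul_cancel₀ _ (Nat.cast_add_one_ne_zero n)]

lemma dvd_of_wronskian_eq_zero {K : Type*} [Field K] [CharZero K] {a s : Polynomial K}
    (ha : a ≠ 0) (h : wronskian a s = 0) : a ∣ s := by
  classical
  let _ : GCDMonoid (Polynomial K) := EuclideanDomain.gcdMonoid _
  have hco := (isCoprime_div_gcd_div_gcd (p := s) ha).symm
  obtain ⟨a₁, ha₁⟩ := gcd_dvd_right s a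
  obtain ⟨s₁, hs₁⟩ := gcd_dvd_left s a
  have hd : gcd s a ≠ 0 := gcd_ne_zero_of_right ha
  set d := gcd s a
  have hda : a / d = a₁ := by rw [ha₁, mul_div_cancel_left₀ _ hd]
  have hds : s / d = s₁ := by rw [hs₁, mul_div_cancel_left₀ _ hd]
  rw [hda, hds] at hco
  have hw : d ^ 2 * wronskian a₁ s₁ = 0 := by
    rw [← h, ha₁, hs₁]
    simp only [wronskian, derivative_mul]
    ring
  have hw₁ := (mul_eq_zero.mp hw).resolve_left (pow_ne_zero 2 hd)
  have hconst := derivative_eq_zero.mp (hco.wronskian_eq_zero_iff.mp hw₁).1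
  have hunit : IsUnit a₁ :=
    isUnit_iff_degree_eq_zero.mpr <| by
      rw [degree_eq_natDegree (right_ne_zero_of_mul (ha₁ ▸ ha)), hconst, Nat.cast_zero]
  rw [ha₁, hunit.mul_right_dvd, hs₁]
  exact dvd_mul_right d s₁

/-- A rational function whose derivative is a polynomial is itself a polynomial. -/
lemma dvd_of_sq_dvd_wronskian {K : Type*} [Field K] [CharZero K] {a s : Polynomial K}
    (ha : a ≠ 0) (h : a ^ 2 ∣ wronskian a s) : a ∣ s := by
  obtain ⟨q, hq⟩ := h
  obtain ⟨Q, rfl⟩ := exists_derivative_eq q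
  rw [← dvd_sub_left (dvd_mul_right a Q)]
  apply dvd_of_wronskian_eq_zero ha
  simp only [wronskian, derivative_sub, derivative_mul] at hq ⊢
  linear_combination hq

lemma Bzero.leadingCoeff_dvd_coeff {f : Polynomial (Polynomial ℂ)} {m k : ℕ}
    (hB : Bzero m f) (hfm : f.natDegree ≤ m) (ha : f.coeff m ≠ 0) (hkm : k < m)
    (hdvd : ∀ j, k < j → f.coeff m ∣ f.coeff j) : f.coeff m ∣ f.coeff k := by
  set a := f.coeff m with ha_def
  set r : Polynomial (Polynomial ℂ) := ∑ j ∈ Finset.range (k + 1), monomial j (f.coeff j)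
    with hr_def
  have hrc (n : ℕ) : r.coeff n = if n ≤ k then f.coeff n else 0 := by
    simp [hr_def, coeff_monomial]
  have hr : r.natDegree ≤ k := by
    rw [natDegree_le_iff_coeff_eq_zero]
    intro N hN
    rw [hrc, if_neg hN.not_ge]
  have hC : C a ∣ f - r := by
    rw [C_dvd_iff_dvd_coeff]
    intro n
    rw [coeff_sub, hrc]
    split_ifs with hn
    · simp
    · simpa using hdvd n (not_le.mp hn)
  obtain ⟨h, hh⟩ := hC
  have hF : (f - r).natDegree ≤ m :=
    (natDegree_sub_le _ _).trans (max_le hfm (hr.trans hkm.le))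
  have key := coeff_X_mul_Tkdv_add hF hr hkm
  obtain ⟨p, hp⟩ : ∃ p, m + k = p + 1 := ⟨m + k - 1, by omega⟩
  rw [sub_add_cancel, coeff_sub, hrc, hrc, if_neg hkm.not_ge, if_pos le_rfl, sub_zero, hp,
    coeff_X_mul, hB p (by omega), hh, Tkdv_C_mul, coeff_X_mul, coeff_C_mul, ← ha_def] at key
  apply dvd_of_sq_dvd_wronskian ha
  have hu : IsUnit (2 * ((m : Polynomial ℂ) - k)) := by
    have : (2 * ((m : Polynomial ℂ) - k)) = C (2 * ((m : ℂ) - k)) := by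
      simp only [C_mul, C_sub, map_ofNat, map_natCast]
    rw [this, isUnit_C, isUnit_iff_ne_zero]
    exact mul_ne_zero two_ne_zero (sub_ne_zero.mpr (by exact_mod_cast hkm.ne'))
  rw [← hu.dvd_mul_left]
  exact ⟨(Tkdv h).coeff p, by linear_combination key⟩

lemma Bzero.C_leadingCoeff_dvd {f : Polynomial (Polynomial ℂ)} {m : ℕ}
    (hB : Bzero m f) (hfm : f.natDegree ≤ m) (ha : f.coeff m ≠ 0) : C (f.coeff m) ∣ f := by
  rw [C_dvd_iff_dvd_coeff]
  have hdesc (d : ℕ) : ∀ j, m ≤ j + d → f.coeff m ∣ f.coeff j := by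
    induction d with
    | zero =>
      intro j hj
      rcases (show m ≤ j from hj).eq_or_lt with rfl | hlt
      · rfl
      · rw [coeff_eq_zero_of_natDegree_lt (hfm.trans_lt hlt)]
        exact dvd_zero _
    | succ d ih =>
      intro j hj
      by_cases hjd : m ≤ j + d
      · exact ih j hjd
      · exact hB.leadingCoeff_dvd_coeff hfm ha (by omega) fun i hi => ih i (by omega)
  exact fun j => hdesc m j (Nat.le_add_left m j)

/-- (i) Every solution `f` of `B_(m) f = 0` with `deg_x f = m` factors as `f = g·h` with
`g ∈ ℂ[t]` the leading `x`-coefficient of `f` and `h` a monic (fundamental) solution of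
`x`-degree `m`. (ii) Conversely, every `ℂ[t]`-multiple of a monic solution is a solution. -/
theorem fundamental_solution_factorization (m : ℕ) (hm : 1 ≤ m) :
    (∀ f : Polynomial (Polynomial ℂ), f.natDegree = m → Bzero m f →
      ∃ (g : Polynomial ℂ) (h : Polynomial (Polynomial ℂ)),
        h.Monic ∧ h.natDegree = m ∧ Bzero m h ∧ f = Polynomial.C g * h ∧ g = f.coeff m)
    ∧ (∀ h : Polynomial (Polynomial ℂ), h.Monic → h.natDegree = m → Bzero m h →
        ∀ g : Polynomial ℂ, Bzero m (Polynomial.C g * h)) := by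
  refine ⟨fun f hf hB => ?_, fun h _ _ hB g p hp => ?_⟩
  · have ha : f.coeff m ≠ 0 := by
      rw [← hf, coeff_natDegree, leadingCoeff_ne_zero]
      rintro rfl
      simp at hf
      omega
    obtain ⟨h, hh⟩ := hB.C_leadingCoeff_dvd hf.le ha
    have hdeg : h.natDegree = m := by
      rw [← natDegree_C_mul ha, ← hh, hf]
    refine ⟨f.coeff m, h, ?_, hdeg, fun p hp => ?_, hh, rfl⟩
    · have hc := congrArg (coeff · m) hh
      simp only [coeff_C_mul] at hc
      rw [Monic, leadingCoeff, hdeg]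
      exact mul_left_cancel₀ ha (by rw [← hc, mul_one])
    · have hT := Tkdv_C_mul (f.coeff m) h
      rw [← hh] at hT
      have hc := hB p hp
      rw [hT, coeff_C_mul] at hc
      exact (mul_eq_zero.mp hc).resolve_left (pow_ne_zero 2 ha)
  · rw [Tkdv_C_mul, coeff_C_mul, hB p hp, mul_zero]
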